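/- Let ε ≥ 0 and define g(x) = x − ε·x·e^{−x²/2} and f(x) = x + ε·x·e^{−x²/2}. Then for all x ≥ 0, the absolute value of the error between g(f(x)) and x satisfies |g(f(x)) − x| ≤ e^{−1}·ε² + (1/2)·e^{−3/2}·ε³. -/

import Mathlib

open Real

lemma mul_exp_neg_sq_half_le (x : ℝ) : x * exp (-x ^ 2 / 2) ≤ exp (-(1 / 2)) := by
  have h : x ≤ exp ((x ^ 2 - 1) / 2) := by
    nlinarith [add_one_le_exp ((x ^ 2 - 1) / 2), sq_nonneg (x - 1)]
  calc x * exp (-x ^ 2 / 2) ≤ exp ((x ^ 2 - 1) / 2) * exp (-x ^ 2 / 2) := by gcongr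
    _ = exp (-(1 / 2)) := by rw [← exp_add]; congr 1; ring

lemma sq_sub_one_mul_exp_neg_sq_half_le (s : ℝ) :
    (s ^ 2 - 1) * exp (-s ^ 2 / 2) ≤ 2 * exp (-(3 / 2)) := by
  have h : s ^ 2 - 1 ≤ 2 * exp ((s ^ 2 - 3) / 2) := by
    linarith [add_one_le_exp ((s ^ 2 - 3) / 2)]
  calc (s ^ 2 - 1) * exp (-s ^ 2 / 2)
      ≤ 2 * exp ((s ^ 2 - 3) / 2) * exp (-s ^ 2 / 2) := by gcongr
    _ = 2 * exp (-(3 / 2)) := by rw [mul_assoc, ← exp_add]; congr 2; ring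

lemma monotone_mul_exp_neg_sq_half_add :
    Monotone fun s : ℝ => s * exp (-s ^ 2 / 2) + 2 * exp (-(3 / 2)) * s := by
  have hd (s : ℝ) : HasDerivAt (fun s : ℝ => s * exp (-s ^ 2 / 2) + 2 * exp (-(3 / 2)) * s)
      ((1 - s ^ 2) * exp (-s ^ 2 / 2) + 2 * exp (-(3 / 2))) s := by
    have h₁ : HasDerivAt (fun s : ℝ => -s ^ 2 / 2) (-s) s :=
      ((hasDerivAt_pow 2 s).neg.div_const 2).congr_deriv (by norm_num; ring)
    exact (((hasDerivAt_id' s).mul h₁.exp).add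
      ((hasDerivAt_id' s).const_mul (2 * exp (-(3 / 2))))).congr_deriv (by ring)
  refine monotone_of_deriv_nonneg (fun s => (hd s).differentiableAt) fun s => ?_
  rw [(hd s).deriv]
  linarith [sq_sub_one_mul_exp_neg_sq_half_le s]

lemma mul_one_sub_sq_mul_exp_neg_sq_le {x : ℝ} (hx : 0 ≤ x) :
    x * (1 - x ^ 2) * exp (-x ^ 2) ≤ exp (-1) := by
  have he : (9 / 25 : ℝ) ≤ exp (-1) := by linarith [exp_neg_one_gt_d9]
  have h₁ : x * (1 - x ^ 2) ≤ 9 / 25 * (x ^ 2 + 1) := by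
    nlinarith [mul_nonneg hx (sq_nonneg (x - 1 / 2)), sq_nonneg (x - 1 / 2)]
  calc x * (1 - x ^ 2) * exp (-x ^ 2) ≤ 9 / 25 * exp (x ^ 2) * exp (-x ^ 2) :=
        mul_le_mul_of_nonneg_right (by linarith [add_one_le_exp (x ^ 2)]) (exp_pos _).le
    _ = 9 / 25 := by rw [mul_assoc, ← exp_add]; simp
    _ ≤ exp (-1) := he

/-- After multiplication by `x ≥ 0`, this bounds the increment of `s ↦ s e^{-s²/2}` over
`[x, x (1 + a)]` by the length of the interval times the positive part of the derivative at `x`. -/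
lemma mul_exp_neg_sq_half_increment_le {x a : ℝ} (ha : 0 ≤ a) :
    (1 + a) * exp (-(x * (1 + a)) ^ 2 / 2) - exp (-x ^ 2 / 2) ≤
      a * max (1 - x ^ 2) 0 * exp (-x ^ 2 / 2) := by
  have hle : exp (-(x * (1 + a)) ^ 2 / 2) ≤ exp (-(a * x ^ 2)) * exp (-x ^ 2 / 2) := by
    rw [← exp_add]
    gcongr
    nlinarith [sq_nonneg (x * a)]
  have hpos : 0 < 1 + a * x ^ 2 := by positivity
  have hinv : (1 + a * x ^ 2) * exp (-(a * x ^ 2)) ≤ 1 := by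
    calc (1 + a * x ^ 2) * exp (-(a * x ^ 2)) ≤ exp (a * x ^ 2) * exp (-(a * x ^ 2)) := by
          gcongr
          linarith [add_one_le_exp (a * x ^ 2)]
      _ = 1 := by rw [← exp_add]; simp
  have hm : (1 + a) ≤ (1 + a * max (1 - x ^ 2) 0) * (1 + a * x ^ 2) := by
    have h₀ := le_max_right (1 - x ^ 2) 0
    have h₁ := mul_le_mul_of_nonneg_left (le_max_left (1 - x ^ 2) 0) ha
    have h₂ : 0 ≤ a * max (1 - x ^ 2) 0 * (a * x ^ 2) := by positivity
    nlinarith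
  have hfac : (1 + a) * exp (-(a * x ^ 2)) ≤ 1 + a * max (1 - x ^ 2) 0 := by
    have h₀ : 0 ≤ 1 + a * max (1 - x ^ 2) 0 := by positivity
    nlinarith [mul_le_mul_of_nonneg_right hm (exp_pos (-(a * x ^ 2))).le,
      mul_le_mul_of_nonneg_left hinv h₀]
  nlinarith [mul_le_mul_of_nonneg_left hle (by positivity : 0 ≤ 1 + a),
    mul_le_mul_of_nonneg_right hfac (exp_pos (-x ^ 2 / 2)).le]

/-- For `ε ≥ 0`, `g x = x - ε x e^{-x²/2}` and `f x = x + ε x e^{-x²/2}`, the error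
between `g (f x)` and `x` satisfies `|g (f x) - x| ≤ e⁻¹ ε² + (1/2) e^{-3/2} ε³`
for all `x ≥ 0`. -/
theorem crrelu_inverse_error_bound
    (ε : ℝ) (hε : 0 ≤ ε) (g f : ℝ → ℝ)
    (hg : ∀ x : ℝ, g x = x - ε * x * Real.exp (-x ^ 2 / 2))
    (hf : ∀ x : ℝ, f x = x + ε * x * Real.exp (-x ^ 2 / 2)) :
    ∀ x : ℝ, 0 ≤ x →
      |g (f x) - x| ≤ Real.exp (-1) * ε ^ 2 + (1 / 2) * Real.exp (-(3 / 2)) * ε ^ 3 := by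
  intro x hx
  have hcube : 0 ≤ (1 / 2) * exp (-(3 / 2)) * ε ^ 3 := by positivity
  suffices h : |g (f x) - x| ≤ exp (-1) * ε ^ 2 by linarith
  have hfx : f x = x * (1 + ε * exp (-x ^ 2 / 2)) := by rw [hf]; ring
  rw [hg, abs_le]
  constructor
  · have hinc := mul_exp_neg_sq_half_increment_le (x := x)
      (by positivity : 0 ≤ ε * exp (-x ^ 2 / 2))
    rw [← hfx] at hinc
    have hsq : exp (-x ^ 2 / 2) * exp (-x ^ 2 / 2) = exp (-x ^ 2) := by
      rw [← exp_add]; congr 1; ring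
    have hmax : x * max (1 - x ^ 2) 0 * exp (-x ^ 2) ≤ exp (-1) := by
      rcases max_cases (1 - x ^ 2) 0 with ⟨h, -⟩ | ⟨h, -⟩ <;> rw [h]
      · exact mul_one_sub_sq_mul_exp_neg_sq_le hx
      · simpa using (exp_pos (-1)).le
    have hmul := mul_le_mul_of_nonneg_left hinc (mul_nonneg hε hx)
    have hlast := mul_le_mul_of_nonneg_right hmax (sq_nonneg ε)
    have hrw : ε * x * (ε * exp (-x ^ 2 / 2) * max (1 - x ^ 2) 0 * exp (-x ^ 2 / 2)) =
        x * max (1 - x ^ 2) 0 * exp (-x ^ 2) * ε ^ 2 := by rw [← hsq]; ring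
    have herr : f x - ε * f x * exp (-f x ^ 2 / 2) - x =
        -(ε * x * ((1 + ε * exp (-x ^ 2 / 2)) * exp (-f x ^ 2 / 2) - exp (-x ^ 2 / 2))) := by
      generalize exp (-f x ^ 2 / 2) = w
      rw [hfx]; ring
    linarith
  · have hxf : x ≤ f x := by
      rw [hf]
      exact le_add_of_nonneg_right (by positivity)
    have hmono := monotone_mul_exp_neg_sq_half_add hxf
    dsimp only at hmono
    have hstep : f x - x = ε * (x * exp (-x ^ 2 / 2)) := by rw [hf]; ring
    have hconst : 2 * exp (-(3 / 2)) * exp (-(1 / 2)) ≤ exp (-1) := by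
      have h₁ : exp (-(3 / 2)) * exp (-(1 / 2)) = exp (-1) * exp (-1) := by
        rw [← exp_add, ← exp_add]; congr 1; norm_num
      have h₂ : exp (-1) ≤ 1 / 2 := by linarith [exp_neg_one_lt_d9]
      nlinarith [exp_pos (-1)]
    calc f x - ε * f x * exp (-f x ^ 2 / 2) - x
        = ε * (x * exp (-x ^ 2 / 2) - f x * exp (-f x ^ 2 / 2)) := by linarith
      _ ≤ ε * (2 * exp (-(3 / 2)) * (f x - x)) := by gcongr; linarith
      _ = 2 * exp (-(3 / 2)) * ε ^ 2 * (x * exp (-x ^ 2 / 2)) := by rw [hstep]; ring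
      _ ≤ 2 * exp (-(3 / 2)) * ε ^ 2 * exp (-(1 / 2)) := by
        gcongr; exact mul_exp_neg_sq_half_le x
      _ = 2 * exp (-(3 / 2)) * exp (-(1 / 2)) * ε ^ 2 := by ring
      _ ≤ exp (-1) * ε ^ 2 := by gcongr
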